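/- Suppose the Frank–Wolfe method is initialized with the pre-start step from λ_0 ∈ Q (so λ_1 := λ̃_0 and h* ≤ B_0 ≤ B^w_0) and run with the simple-averaging step sizes ᾱ_i = 1/(i+1) for i ≥ 1. If C ≥ 0 is a curvature bound for (h,Q), then for all k ≥ 2: min_{i∈{1,…,k}} G_i ≤ (3C/4)·(2.3 + 2·ln(k))/(k−1). -/

import Mathlib

/-- The increment of the logarithm is at most the left-endpoint value of `1 / x`. -/
lemma log_add_one_sub_log_le {x : ℝ} (hx : 0 < x) :
    Real.log (x + 1) - Real.log x ≤ 1 / x := by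
  rw [← Real.log_div (by positivity) hx.ne']
  have := Real.log_le_sub_one_of_pos (show 0 < (x + 1) / x by positivity)
  have e : (x + 1) / x - 1 = 1 / x := by field_simp; ring
  linarith

/-- The increment of the logarithm is at least the right-endpoint value of `1 / x`. -/
lemma one_div_le_log_add_one_sub_log {x : ℝ} (hx : 0 < x) :
    1 / (x + 1) ≤ Real.log (x + 1) - Real.log x := by
  rw [← Real.log_div (by positivity) hx.ne']
  have := Real.one_sub_inv_le_log_of_pos (show 0 < (x + 1) / x by positivity)
  have e : 1 - ((x + 1) / x)⁻¹ = 1 / (x + 1) := by field_simp; ring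
  linarith

/-- A sequence of optimality gaps contracted with step sizes `1 / (n + 1)` is `O(log n / n)`. -/
lemma mul_gap_le_log {d G : ℕ → ℝ} {C : ℝ} (hC : 0 ≤ C) (h1 : d 1 ≤ C / 2)
    (hdG : ∀ n, 1 ≤ n → d n ≤ G n)
    (hstep : ∀ n : ℕ, 1 ≤ n →
      d (n + 1) ≤ d n - 1 / ((n : ℝ) + 1) * G n + C / 2 * (1 / ((n : ℝ) + 1)) ^ 2)
    {n : ℕ} (hn : 1 ≤ n) : n * d n ≤ C / 2 * (1 + Real.log n) := by
  induction n, hn using Nat.le_induction with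
  | base => simpa using h1
  | succ n hn ih =>
    have hn0 : (0 : ℝ) < n := by exact_mod_cast hn
    have hs : ((n : ℝ) + 1) * d (n + 1) ≤ n * d n + C / 2 * (1 / ((n : ℝ) + 1)) := by
      calc ((n : ℝ) + 1) * d (n + 1)
          ≤ (n + 1) * (d n - 1 / ((n : ℝ) + 1) * G n + C / 2 * (1 / ((n : ℝ) + 1)) ^ 2) := by
            gcongr
            exact hstep n hn
        _ = (n + 1) * d n - G n + C / 2 * (1 / ((n : ℝ) + 1)) := by field_simp
        _ ≤ n * d n + C / 2 * (1 / ((n : ℝ) + 1)) := by linarith [hdG n hn]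
    have hl := mul_le_mul_of_nonneg_left (one_div_le_log_add_one_sub_log hn0)
      (by positivity : 0 ≤ C / 2)
    push_cast
    linarith

/-- Telescoping the progress inequality, with a uniform lower bound `m` on the gaps `G`. -/
lemma mul_log_sub_log_le {d G : ℕ → ℝ} {C m : ℝ} (hC : 0 ≤ C) (hm : 0 ≤ m)
    (hstep : ∀ n : ℕ, 1 ≤ n →
      d (n + 1) ≤ d n - 1 / ((n : ℝ) + 1) * G n + C / 2 * (1 / ((n : ℝ) + 1)) ^ 2)
    {j n : ℕ} (hj : 1 ≤ j) (hjn : j ≤ n) (hmG : ∀ i, j ≤ i → i < n → m ≤ G i) :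
    d n + m * (Real.log (n + 1) - Real.log (j + 1)) ≤
      d j + C / 2 * (1 / (j : ℝ) - 1 / (n : ℝ)) := by
  induction n, hjn using Nat.le_induction with
  | base => simp
  | succ n hjn ih =>
    have hn0 : (0 : ℝ) < n := by exact_mod_cast hj.trans hjn
    have ih := ih fun i hi hin => hmG i hi (by omega)
    have hs := hstep n (hj.trans hjn)
    have hl := mul_le_mul_of_nonneg_left
      (log_add_one_sub_log_le (by positivity : (0 : ℝ) < n + 1)) hm
    have hg := mul_le_mul_of_nonneg_left (hmG n hjn (by omega))
      (by positivity : 0 ≤ 1 / ((n : ℝ) + 1))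
    have hsq : (1 / ((n : ℝ) + 1)) ^ 2 ≤ 1 / (n : ℝ) - 1 / ((n : ℝ) + 1) := by
      have e : 1 / (n : ℝ) - 1 / ((n : ℝ) + 1) = 1 / (n * (n + 1)) := by field_simp; ring
      rw [e, div_pow, one_pow]
      apply one_div_le_one_div_of_le (by positivity)
      nlinarith
    have hsqC := mul_le_mul_of_nonneg_left hsq (by positivity : 0 ≤ C / 2)
    push_cast
    linarith

/-- Numerical estimate behind the bound with the constant `2.3`, for `j = ⌊k / 2⌋`. -/
lemma half_index_estimate {j k : ℕ} (hj : 1 ≤ j) (h2j : 2 * j ≤ k) (hk2j : k ≤ 2 * j + 1) :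
    (1 + Real.log j) / j + (1 / (j : ℝ) - 1 / ((k : ℝ) + 1)) ≤
      (2.3 + 2 * Real.log k) / ((k : ℝ) - 1) := by
  have hj1 : (1 : ℝ) ≤ j := by exact_mod_cast hj
  have h2 : 2 * (j : ℝ) ≤ k := by exact_mod_cast h2j
  have h3 : (k : ℝ) ≤ 2 * j + 1 := by exact_mod_cast hk2j
  have hk : (0 : ℝ) < (k : ℝ) - 1 := by linarith
  have hlog : Real.log 2 + Real.log j ≤ Real.log k := by
    rw [← Real.log_mul (by norm_num) (by positivity)]
    exact Real.log_le_log (by positivity) h2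
  have hl2 := Real.log_two_gt_d9
  have hlj := Real.log_nonneg hj1
  have hA : (1 + Real.log j) / j + 1 / (j : ℝ) ≤ 2 * (2 + Real.log j) / ((k : ℝ) - 1) := by
    rw [← add_div, div_le_div_iff₀ (by positivity) hk]
    nlinarith
  have hB : 0.314 / ((k : ℝ) - 1) ≤ 1 / ((k : ℝ) + 1) := by
    rw [div_le_div_iff₀ hk (by linarith)]
    linarith
  have hD : 2 * (2 + Real.log j) / ((k : ℝ) - 1) - 0.314 / ((k : ℝ) - 1) ≤
      (2.3 + 2 * Real.log k) / ((k : ℝ) - 1) := by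
    rw [← sub_div]
    gcongr
    linarith
  linarith


theorem frank_wolfe_fw_gap_simple_averaging
    {E : Type*} [NormedAddCommGroup E] [NormedSpace ℝ E] [FiniteDimensional ℝ E]
    (Q : Set E) (hQne : Q.Nonempty) (hQcomp : IsCompact Q) (hQconv : Convex ℝ Q)
    (U : Set E) (hUopen : IsOpen U) (hQU : Q ⊆ U)
    (h : E → ℝ) (hconc : ConcaveOn ℝ Set.univ h) (hdiff : DifferentiableOn ℝ h U)
    (hstar : ℝ) (hhstar : IsGreatest (h '' Q) hstar)
    (C : ℝ) (hC : 0 ≤ C)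
    (hcurv : ∀ lam ∈ Q, ∀ lam' ∈ Q, ∀ a ∈ Set.Icc (0:ℝ) 1,
      h (lam + a • (lam' - lam)) ≥
        h lam + a * (fderiv ℝ h lam) (lam' - lam) - C / 2 * a ^ 2)
    (ab : ℕ → ℝ) (lam lamt : ℕ → E) (Bw G B : ℕ → ℝ)
    (hab : ∀ k, 1 ≤ k → ab k ∈ Set.Ico (0:ℝ) 1)
    (hlam0 : lam 0 ∈ Q)
    (hlamtQ : ∀ k, lamt k ∈ Q)
    (hargmax : ∀ k, ∀ l ∈ Q,
      (fderiv ℝ h (lam k)) (l - lam k) ≤ (fderiv ℝ h (lam k)) (lamt k - lam k))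
    (hBw : ∀ k, Bw k = h (lam k) + (fderiv ℝ h (lam k)) (lamt k - lam k))
    (hG : ∀ k, G k = (fderiv ℝ h (lam k)) (lamt k - lam k))
    (hprestart : lam 1 = lamt 0)
    (hnext : ∀ k, 1 ≤ k → lam (k+1) = lam k + ab k • (lamt k - lam k))
    (hBlb : ∀ k, hstar ≤ B k)
    (hBmono : ∀ k, 1 ≤ k → B k ≤ B (k-1))
    (hBBw : ∀ k, B k ≤ Bw k)
    (habval : ∀ i, 1 ≤ i → ab i = 1 / ((i : ℝ) + 1))
    :
    ∀ (k : ℕ) (hk : 2 ≤ k),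
      (Finset.Icc 1 k).inf' (Finset.nonempty_Icc.mpr (by omega)) G ≤
        3 * C / 4 * (2.3 + 2 * Real.log (k : ℝ)) / ((k : ℝ) - 1) := by
  have hlamQ : ∀ n, 1 ≤ n → lam n ∈ Q := by
    intro n hn
    induction n, hn using Nat.le_induction with
    | base => exact hprestart ▸ hlamtQ 0
    | succ n hn ih =>
      rw [hnext n hn]
      exact hQconv.add_smul_sub_mem ih (hlamtQ n) ⟨(hab n hn).1, (hab n hn).2.le⟩
  have hGgap : ∀ n, hstar - h (lam n) ≤ G n := fun n => by
    linarith [hBlb n, hBBw n, hBw n, hG n]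
  have hgap : ∀ n, 1 ≤ n → 0 ≤ hstar - h (lam n) := fun n hn =>
    sub_nonneg.mpr (hhstar.2 ⟨lam n, hlamQ n hn, rfl⟩)
  have hfirst : hstar - h (lam 1) ≤ C / 2 := by
    have hc := hcurv (lam 0) hlam0 (lamt 0) (hlamtQ 0) 1 ⟨zero_le_one, le_rfl⟩
    rw [one_smul, add_sub_cancel, ← hG] at hc
    rw [hprestart]
    linarith [hGgap 0]
  have hstep : ∀ n : ℕ, 1 ≤ n → hstar - h (lam (n + 1)) ≤
      hstar - h (lam n) - 1 / ((n : ℝ) + 1) * G n + C / 2 * (1 / ((n : ℝ) + 1)) ^ 2 := by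
    intro n hn
    have hc := hcurv (lam n) (hlamQ n hn) (lamt n) (hlamtQ n) (ab n)
      ⟨(hab n hn).1, (hab n hn).2.le⟩
    rw [← hnext n hn, ← hG, habval n hn] at hc
    linarith
  intro k hk
  set m := (Finset.Icc 1 k).inf' (Finset.nonempty_Icc.mpr (by omega)) G
  have hmG : ∀ i, 1 ≤ i → i ≤ k → m ≤ G i := fun i h1 h2 =>
    Finset.inf'_le G (Finset.mem_Icc.mpr ⟨h1, h2⟩)
  have hm : 0 ≤ m := Finset.le_inf' _ _ fun i hi =>
    (hgap i (Finset.mem_Icc.mp hi).1).trans (hGgap i)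
  obtain ⟨j, hj, h2j, hk2j⟩ : ∃ j, 1 ≤ j ∧ 2 * j ≤ k ∧ k ≤ 2 * j + 1 :=
    ⟨k / 2, by omega, by omega, by omega⟩
  have hj0 : (0 : ℝ) < j := by exact_mod_cast hj
  have htel := mul_log_sub_log_le (d := fun n => hstar - h (lam n)) hC hm hstep hj
    (show j ≤ k + 1 by omega) fun i hi hik => hmG i (hj.trans hi) (by omega)
  have hdj := mul_gap_le_log (d := fun n => hstar - h (lam n)) hC hfirst
    (fun n _ => hGgap n) hstep hj
  have hdj' : hstar - h (lam j) ≤ C / 2 * ((1 + Real.log j) / j) := by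
    rw [← mul_div_assoc, le_div_iff₀ hj0]
    linarith
  have hlog : 2 / 3 ≤ Real.log ((k + 1 : ℕ) + 1) - Real.log (j + 1) := by
    have hle : Real.log (2 * ((j : ℝ) + 1)) ≤ Real.log ((k + 1 : ℕ) + 1) := by
      apply Real.log_le_log (by positivity)
      have : 2 * (j : ℝ) ≤ k := by exact_mod_cast h2j
      push_cast
      linarith
    rw [Real.log_mul (by norm_num) (by positivity)] at hle
    linarith [Real.log_two_gt_d9]
  have hml := mul_le_mul_of_nonneg_left hlog hm
  have hest := mul_le_mul_of_nonneg_left (half_index_estimate hj h2j hk2j)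
    (by positivity : 0 ≤ 3 * C / 4)
  rw [← mul_div_assoc] at hest
  have hlast := hgap (k + 1) (by omega)
  push_cast at htel hml
  linarith
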